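/- For every finite simple matroid M of rank r+1 and every integer k with 0 ≤ 2k < r, there exists an injection λ : FY^k → FY^{k+1} that is equivariant for the action of the automorphism group G of M, i.e., λ(g·a) = g·λ(a) for all g ∈ G and a ∈ FY^k. -/

import Mathlib

open Finset

/-- A finite simple matroid, presented by its lattice of flats and rank function. -/
structure SimpleFlatMatroid (E : Type*) [Fintype E] [DecidableEq E] where
  /-- the collection of flats -/
  flats : Finset (Finset E)
  /-- the rank function -/
  rk : Finset E → ℕ
  /-- (F1): the ground set is a flat -/
  ground_mem : (Finset.univ : Finset E) ∈ flats
  /-- (F2): flats are closed under intersection -/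
  inter_mem : ∀ F ∈ flats, ∀ F' ∈ flats, F ∩ F' ∈ flats
  /-- (F3): for a flat `F` and `i ∉ F` there is a unique flat containing `i` covering `F` -/
  cover_axiom : ∀ F ∈ flats, ∀ i : E, i ∉ F →
    ∃! F' : Finset E, F' ∈ flats ∧ i ∈ F' ∧ F ⊂ F' ∧
      ¬ ∃ F'' ∈ flats, F ⊂ F'' ∧ F'' ⊂ F'
  /-- simplicity: no loops, i.e. `∅` is a flat -/
  empty_mem : (∅ : Finset E) ∈ flats
  /-- simplicity: no parallel elements, i.e. all singletons are flats -/
  singleton_mem : ∀ i : E, ({i} : Finset E) ∈ flats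
  /-- normalization of the rank function -/
  rk_empty : rk ∅ = 0
  /-- the rank function increases by one along covers of flats -/
  rk_cover : ∀ F ∈ flats, ∀ F' ∈ flats, F ⊂ F' →
    (¬ ∃ F'' ∈ flats, F ⊂ F'' ∧ F'' ⊂ F') → rk F' = rk F + 1

namespace SimpleFlatMatroid

variable {E : Type*} [Fintype E] [DecidableEq E]

/-- We encode a (squarefree-or-not) monomial in the variables `x_F` as the function
sending each `F` to the exponent of `x_F`.  `prevFlat m F` is the union of all flats
in the support of `m` strictly contained in `F`; when the support of `m` is a chain
this is the predecessor of `F` in the support (or `∅` if there is none). -/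
def prevFlat (m : Finset E → ℕ) (F : Finset E) : Finset E :=
  Finset.univ.sup fun F' => if m F' ≠ 0 ∧ F' ⊂ F then F' else ∅

/-- The total degree of a monomial. -/
def deg (m : Finset E → ℕ) : ℕ := ∑ F : Finset E, m F

variable (M : SimpleFlatMatroid E)

/-- `m` is an FY-monomial: its support is a chain `F₁ ⊊ ⋯ ⊊ F_ℓ` of nonempty flats
with `m Fᵢ ≤ rk(Fᵢ) - rk(Fᵢ₋₁) - 1` for all `i` (with `F₀ := ∅`). -/
def IsFY (m : Finset E → ℕ) : Prop :=
  (∀ F : Finset E, m F ≠ 0 → F ∈ M.flats ∧ F ≠ ∅) ∧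
  (∀ F F' : Finset E, m F ≠ 0 → m F' ≠ 0 → F ⊆ F' ∨ F' ⊆ F) ∧
  (∀ F : Finset E, m F ≠ 0 → m F + M.rk (prevFlat m F) + 1 ≤ M.rk F)

/-- The set `FY^k` of FY-monomials of total degree `k`, as a type. -/
abbrev FYk (k : ℕ) : Type _ := {m : Finset E → ℕ // M.IsFY m ∧ deg m = k}

/-- `g` is an automorphism of the matroid: a permutation of the ground set carrying
flats to flats. -/
def IsAut (g : Equiv.Perm E) : Prop := ∀ F ∈ M.flats, F.image g ∈ M.flats

/-- The action of a permutation `g` on monomials: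
`g ⋅ (x_{F₁}^{m₁} ⋯ x_{F_ℓ}^{m_ℓ}) = x_{g F₁}^{m₁} ⋯ x_{g F_ℓ}^{m_ℓ}`. -/
def mact (g : Equiv.Perm E) (m : Finset E → ℕ) : Finset E → ℕ :=
  fun F => m (F.image (g⁻¹ : Equiv.Perm E))

end SimpleFlatMatroid

/-- Symmetric unimodality about `N/2` of an integer-indexed sequence. -/
def SymUnimod (a : ℤ → ℕ) (N : ℤ) : Prop :=
  (∀ k, a (N - k) = a k) ∧ ∀ i j, i ≤ j → i + j ≤ N → a i ≤ a j

theorem SymUnimod.step {a : ℤ → ℕ} {N : ℤ} (h : SymUnimod a N) (l c : ℕ) :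
    SymUnimod (fun k => ∑ j ∈ range (c + 1), a (k - (l + j : ℕ))) (N + 2 * l + c) := by
  obtain ⟨hs, hm⟩ := h
  have sym : ∀ k : ℤ, (∑ j ∈ range (c + 1), a (N + 2 * l + c - k - (l + j : ℕ)))
      = ∑ j ∈ range (c + 1), a (k - (l + j : ℕ)) := by
    intro k
    rw [← Finset.sum_range_reflect]
    refine Finset.sum_congr rfl fun j hj => ?_
    rw [← hs]
    congr 1
    have : j ≤ c := by simpa [Nat.lt_succ_iff] using hj
    push_cast [Nat.cast_sub, this, show c + 1 - 1 - j = c - j by omega]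
    ring
  have st : ∀ k : ℤ, 2 * k + 1 ≤ N + 2 * l + c →
      (∑ j ∈ range (c + 1), a (k - (l + j : ℕ))) ≤ ∑ j ∈ range (c + 1), a (k + 1 - (l + j : ℕ)) := by
    intro k hk
    rw [Finset.sum_range_succ, Finset.sum_range_succ' _ c]
    refine add_le_add (Finset.sum_le_sum fun j _ => ?_) (hm _ _ ?_ ?_)
    · refine le_of_eq ?_
      congr 1
      push_cast
      ring
    · push_cast; omega
    · push_cast; omega
  refine ⟨sym, ?_⟩
  have mono : ∀ (d : ℕ) (i : ℤ), 2 * (i + d) ≤ N + 2 * l + c + 1 →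
      (∑ j ∈ range (c + 1), a (i - (l + j : ℕ))) ≤ ∑ j ∈ range (c + 1), a (i + d - (l + j : ℕ)) := by
    intro d
    induction d with
    | zero => intro i _; simp
    | succ d ih =>
      intro i hi
      refine (ih i (by push_cast at hi; omega)).trans ?_
      refine (st (i + d) (by push_cast at hi; omega)).trans (le_of_eq ?_)
      refine Finset.sum_congr rfl fun j _ => ?_
      congr 1
      push_cast
      ring
  intro i j hij hN
  by_cases hj : 2 * j ≤ N + 2 * l + c + 1
  · have := mono (j - i).toNat i (by omega)
    rwa [show i + ((j - i).toNat : ℤ) = j by omega] at this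
  · have := mono (N + 2 * l + c - j - i).toNat i (by omega)
    rw [show i + ((N + 2 * l + c - j - i).toNat : ℤ) = N + 2 * l + c - j by omega, sym] at this
    exact this

theorem symUnimod_prod {ι : Type*} [DecidableEq ι] (s : Finset ι) (l c : ι → ℕ) :
    SymUnimod (fun k => (∏ i ∈ s, ∑ j ∈ range (c i + 1),
      (AddMonoidAlgebra.single ((l i + j : ℕ) : ℤ) 1 : AddMonoidAlgebra ℕ ℤ)).coeff k)
      (∑ i ∈ s, (2 * (l i : ℤ) + c i)) := by
  induction s using Finset.induction_on with
  | empty =>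
    simp only [prod_empty, sum_empty, AddMonoidAlgebra.one_def, AddMonoidAlgebra.coeff_single]
    constructor
    · intro k; simp [Finsupp.single_apply, eq_comm]
    · intro i j h1 h2
      simp only [Finsupp.single_apply]
      split_ifs <;> omega
  | insert x s hx ih =>
    rw [Finset.sum_insert hx]
    have := ih.step (l x) (c x)
    convert this using 1
    · ext k
      rw [Finset.prod_insert hx, mul_comm, Finset.mul_sum, AddMonoidAlgebra.coeff_sum,
        Finsupp.finsetSum_apply]
      refine Finset.sum_congr rfl fun j _ => ?_
      rw [AddMonoidAlgebra.coeff_mul_single_apply]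
      simp [sub_eq_add_neg]
    · ring

theorem card_level_le {ι : Type*} [DecidableEq ι] [Fintype ι] (l c : ι → ℕ) (k : ℕ)
    (hk : 2 * k < ∑ i, (2 * l i + c i)) :
    #{f ∈ Fintype.piFinset fun i => range (c i + 1) | ∑ i, (l i + f i) = k} ≤
    #{f ∈ Fintype.piFinset fun i => range (c i + 1) | ∑ i, (l i + f i) = k + 1} := by
  have key : ∀ k : ℕ, #{f ∈ Fintype.piFinset fun i => range (c i + 1) | ∑ i, (l i + f i) = k} =
      (∏ i, ∑ j ∈ range (c i + 1),
      (AddMonoidAlgebra.single ((l i + j : ℕ) : ℤ) 1 : AddMonoidAlgebra ℕ ℤ)).coeff (k : ℤ) := by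
    intro k
    rw [Finset.prod_univ_sum, AddMonoidAlgebra.coeff_sum, Finsupp.finsetSum_apply, Finset.card_filter]
    refine Finset.sum_congr rfl fun f _ => ?_
    rw [AddMonoidAlgebra.prod_single, AddMonoidAlgebra.coeff_single, Finsupp.single_apply]
    simp only [prod_const_one]
    refine if_congr ?_ rfl rfl
    rw [← Nat.cast_sum]
    exact Nat.cast_inj.symm
  rw [key, key]
  refine (symUnimod_prod univ l c).2 _ _ (by simp) ?_
  have : (2 * (k : ℤ)) < ∑ i, (2 * (l i : ℤ) + c i) := by exact_mod_cast hk
  push_cast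
  omega

/-- Level-raising injection on a product of intervals. -/
theorem exists_level_injection (R : Finset ℕ) (l u : ℕ → ℕ) (hlu : ∀ n ∈ R, l n ≤ u n) (k : ℕ)
    (hk : 2 * k < ∑ n ∈ R, (l n + u n)) :
    ∃ φ : (ℕ → ℕ) → (ℕ → ℕ),
      (∀ f, (∀ n ∈ R, l n ≤ f n ∧ f n ≤ u n) → ∑ n ∈ R, f n = k →
        (∀ n ∈ R, l n ≤ φ f n ∧ φ f n ≤ u n) ∧ ∑ n ∈ R, φ f n = k + 1) ∧
      (∀ f f', (∀ n ∈ R, l n ≤ f n ∧ f n ≤ u n) → ∑ n ∈ R, f n = k →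
        (∀ n ∈ R, l n ≤ f' n ∧ f' n ≤ u n) → ∑ n ∈ R, f' n = k →
        (∀ n ∈ R, φ f n = φ f' n) → ∀ n ∈ R, f n = f' n) := by
  classical
  have hc := card_level_le (ι := R) (fun i => l i) (fun i => u i - l i) k (by
    rw [Finset.sum_coe_sort R (fun n => 2 * l n + (u n - l n))]
    convert hk using 1
    refine Finset.sum_congr rfl fun n hn => ?_
    have := hlu n hn
    omega)
  rw [← Fintype.card_coe, ← Fintype.card_coe] at hc
  obtain ⟨e⟩ := Function.Embedding.nonempty_of_card_le hc
  have mem : ∀ f : ℕ → ℕ, (∀ n ∈ R, l n ≤ f n ∧ f n ≤ u n) → ∑ n ∈ R, f n = k →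
      (fun i : R => f i - l i) ∈ {f ∈ Fintype.piFinset fun i : R => range (u i - l i + 1) |
        ∑ i : R, (l i + f i) = k} := by
    intro f hf hs
    simp only [mem_filter, Fintype.mem_piFinset, mem_range]
    refine ⟨fun i => by have := hf i i.2; omega, ?_⟩
    rw [← hs, ← Finset.sum_coe_sort R f]
    refine Finset.sum_congr rfl fun i _ => ?_
    have := hf i i.2
    omega
  let φ : (ℕ → ℕ) → (ℕ → ℕ) := fun f n =>
    if h : (∀ n ∈ R, l n ≤ f n ∧ f n ≤ u n) ∧ ∑ n ∈ R, f n = k then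
      if hn : n ∈ R then l n + (e ⟨_, mem f h.1 h.2⟩).1 ⟨n, hn⟩ else 0
    else 0
  have hφ : ∀ f (h1 : ∀ n ∈ R, l n ≤ f n ∧ f n ≤ u n) (h2 : ∑ n ∈ R, f n = k) (i : R),
      φ f i = l i + (e ⟨_, mem f h1 h2⟩).1 i := by
    intro f h1 h2 i
    simp only [φ]
    rw [dif_pos ⟨h1, h2⟩, dif_pos i.2]
  refine ⟨φ, ?_, ?_⟩
  · intro f h1 h2
    have hm := (e ⟨_, mem f h1 h2⟩).2
    simp only [mem_filter, Fintype.mem_piFinset, mem_range] at hm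
    constructor
    · intro n hn
      have h3 := hφ f h1 h2 ⟨n, hn⟩
      have h4 := hm.1 ⟨n, hn⟩
      have h5 := hlu n hn
      simp only at h3 h4
      rw [h3]
      omega
    · rw [← Finset.sum_coe_sort R, ← hm.2]
      exact Finset.sum_congr rfl fun i _ => hφ f h1 h2 i
  · intro f f' h1 h2 h1' h2' h n hn
    have : e ⟨_, mem f h1 h2⟩ = e ⟨_, mem f' h1' h2'⟩ := by
      apply Subtype.ext
      funext i
      have := h i i.2
      rw [hφ f h1 h2, hφ f' h1' h2'] at this
      omega
    have h3 := congrFun (congrArg Subtype.val (e.injective this)) ⟨n, hn⟩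
    simp only at h3
    have := h1 n hn
    have := h1' n hn
    omega

/-- Predecessor of `n` in `R` (or `0`). -/
def predIn (R : Finset ℕ) (n : ℕ) : ℕ := ({j ∈ R | j < n}).sup id

theorem sum_sub_pred (R : Finset ℕ) : ∑ n ∈ R, (n - predIn R n) = R.sup id := by
  induction R using Finset.induction_on_max with
  | empty => simp
  | insert a s ha ih =>
    have has : a ∉ s := fun h => lt_irrefl _ (ha a h)
    rw [Finset.sum_insert has]
    have h1 : predIn (insert a s) a = s.sup id := by
      unfold predIn
      congr 1
      ext j
      simp only [mem_filter, mem_insert]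
      constructor
      · rintro ⟨rfl | h, h'⟩
        · omega
        · exact h
      · exact fun h => ⟨Or.inr h, ha j h⟩
    have h2 : ∀ n ∈ s, predIn (insert a s) n = predIn s n := by
      intro n hn
      unfold predIn
      congr 1
      ext j
      simp only [mem_filter, mem_insert]
      have := ha n hn
      constructor
      · rintro ⟨rfl | h, h'⟩
        · omega
        · exact ⟨h, h'⟩
      · exact fun h => ⟨Or.inr h.1, h.2⟩
    rw [Finset.sum_congr rfl fun n hn => by rw [h2 n hn], ih, h1, Finset.sup_insert]
    have : s.sup id ≤ a := Finset.sup_le fun j hj => (ha j hj).le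
    simp only [id]
    rw [sup_eq_left.2 this]
    omega

theorem predIn_lt {R : Finset ℕ} {n : ℕ} (hn : 0 < n) : predIn R n < n := by
  unfold predIn
  rw [Finset.sup_lt_iff (by simpa using hn)]
  intro j hj
  exact (mem_filter.1 hj).2

/-- lower bounds -/
def loB (r n : ℕ) : ℕ := if n = r + 1 then 0 else 1

/-- upper bounds -/
def upB (R : Finset ℕ) (n : ℕ) : ℕ := n - predIn R n - 1

theorem sum_bounds (R : Finset ℕ) (r : ℕ) (hr : r + 1 ∈ R) (hR : ∀ n ∈ R, 0 < n ∧ n ≤ r + 1) :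
    ∑ n ∈ R, (loB r n + upB R n) = r := by
  have h1 : ∑ n ∈ R, (n - predIn R n) = r + 1 := by
    rw [sum_sub_pred]
    exact le_antisymm (Finset.sup_le fun n hn => (hR n hn).2) (Finset.le_sup (f := id) hr)
  rw [← Finset.add_sum_erase _ _ hr] at h1 ⊢
  have h2 : ∑ n ∈ R.erase (r + 1), (loB r n + upB R n) = ∑ n ∈ R.erase (r + 1), (n - predIn R n) := by
    refine Finset.sum_congr rfl fun n hn => ?_
    have := predIn_lt (R := R) (hR n (mem_of_mem_erase hn)).1
    simp only [loB, upB, if_neg (ne_of_mem_erase hn)]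
    omega
  rw [h2]
  have := predIn_lt (R := R) (hR _ hr).1
  simp only [loB, upB, if_true]
  omega

namespace SimpleFlatMatroid

variable {E : Type*} [Fintype E] [DecidableEq E] (M : SimpleFlatMatroid E)

theorem rk_strict : ∀ (d : ℕ) (F F' : Finset E), F'.card - F.card = d → F ∈ M.flats →
    F' ∈ M.flats → F ⊂ F' → M.rk F < M.rk F' := by
  intro d
  induction d using Nat.strong_induction_on with
  | _ d ih =>
    intro F F' hd hF hF' hlt
    by_cases h : ∃ F'' ∈ M.flats, F ⊂ F'' ∧ F'' ⊂ F'
    · obtain ⟨G, hG, h1, h2⟩ := h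
      have c1 := Finset.card_lt_card h1
      have c2 := Finset.card_lt_card h2
      exact (ih _ (by omega) F G rfl hF hG h1).trans (ih _ (by omega) G F' rfl hG hF' h2)
    · have := M.rk_cover F hF F' hF' hlt h
      omega

theorem rk_lt {F F' : Finset E} (hF : F ∈ M.flats) (hF' : F' ∈ M.flats) (h : F ⊂ F') :
    M.rk F < M.rk F' := M.rk_strict _ F F' rfl hF hF' h

theorem rk_le {F F' : Finset E} (hF : F ∈ M.flats) (hF' : F' ∈ M.flats) (h : F ⊆ F') :
    M.rk F ≤ M.rk F' := by
  rcases h.eq_or_ssubset with rfl | h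
  · exact le_rfl
  · exact (M.rk_lt hF hF' h).le

theorem image_inv_image (g : Equiv.Perm E) (F : Finset E) :
    (F.image g).image (g⁻¹ : Equiv.Perm E) = F := by
  ext x
  simp [Finset.mem_image]

theorem image_image_inv (g : Equiv.Perm E) (F : Finset E) :
    (F.image (g⁻¹ : Equiv.Perm E)).image g = F := by
  ext x
  simp [Finset.mem_image]

variable {M}

theorem IsAut.inv {g : Equiv.Perm E} (hg : M.IsAut g) : M.IsAut g⁻¹ := by
  intro F hF
  have hinj : Function.Injective (fun F : Finset E => F.image g) :=
    Finset.image_injective g.injective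
  have hsub : M.flats.image (fun F : Finset E => F.image g) ⊆ M.flats := by
    intro H hH
    obtain ⟨G, hG, rfl⟩ := Finset.mem_image.1 hH
    exact hg G hG
  have heq := Finset.eq_of_subset_of_card_le hsub (by rw [Finset.card_image_of_injective _ hinj])
  rw [← heq] at hF
  obtain ⟨G, hG, rfl⟩ := Finset.mem_image.1 hF
  rw [image_inv_image]
  exact hG

theorem IsAut.rk_image {g : Equiv.Perm E} (hg : M.IsAut g) :
    ∀ F ∈ M.flats, M.rk (F.image g) = M.rk F := by
  intro F
  induction F using Finset.strongInduction with
  | H F ih =>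
    intro hF
    rcases F.eq_empty_or_nonempty with rfl | hne
    · simp
    · obtain ⟨G, hG, hmax⟩ := Finset.exists_max_image ({G ∈ M.flats | G ⊂ F}) Finset.card
        ⟨∅, by simp [M.empty_mem, Finset.empty_ssubset.2 hne]⟩
      rw [Finset.mem_filter] at hG
      have hcov : ¬ ∃ F'' ∈ M.flats, G ⊂ F'' ∧ F'' ⊂ F := by
        rintro ⟨H, hH, h1, h2⟩
        have := hmax H (Finset.mem_filter.2 ⟨hH, h2⟩)
        have := Finset.card_lt_card h1
        omega
      rw [M.rk_cover G hG.1 F hF hG.2 hcov, ← ih G hG.2 hG.1]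
      refine M.rk_cover _ (hg G hG.1) _ (hg F hF) ?_ ?_
      · exact (Finset.image_ssubset_image g.injective).2 hG.2
      · rintro ⟨H, hH, h1, h2⟩
        refine hcov ⟨H.image (g⁻¹ : Equiv.Perm E), hg.inv H hH, ?_, ?_⟩
        · rw [← image_inv_image g G]
          exact (Finset.image_ssubset_image (g⁻¹ : Equiv.Perm E).injective).2 h1
        · rw [← image_inv_image g F]
          exact (Finset.image_ssubset_image (g⁻¹ : Equiv.Perm E).injective).2 h2

/-- extended support -/
def xsupp (m : Finset E → ℕ) : Finset (Finset E) := {F | m F ≠ 0 ∨ F = Finset.univ}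

theorem mem_xsupp {m : Finset E → ℕ} {F : Finset E} :
    F ∈ xsupp m ↔ m F ≠ 0 ∨ F = Finset.univ := by simp [xsupp]

variable (M) in
/-- A chain of flats containing the ground set. -/
def IsXChain (S : Finset (Finset E)) : Prop :=
  Finset.univ ∈ S ∧ (∀ F ∈ S, F ∈ M.flats ∧ F ≠ ∅) ∧ ∀ F ∈ S, ∀ F' ∈ S, F ⊆ F' ∨ F' ⊆ F

theorem IsXChain.ssubset {S : Finset (Finset E)} (hS : M.IsXChain S) {F F' : Finset E}
    (hF : F ∈ S) (hF' : F' ∈ S) (h : M.rk F < M.rk F') : F ⊂ F' := by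
  rcases hS.2.2 F hF F' hF' with h1 | h1
  · refine h1.ssubset_of_ne ?_
    rintro rfl
    exact lt_irrefl _ h
  · have := M.rk_le (hS.2.1 _ hF').1 (hS.2.1 _ hF).1 h1
    omega

theorem IsXChain.rk_inj {S : Finset (Finset E)} (hS : M.IsXChain S) {F F' : Finset E}
    (hF : F ∈ S) (hF' : F' ∈ S) (h : M.rk F = M.rk F') : F = F' := by
  rcases hS.2.2 F hF F' hF' with h1 | h1
  · by_contra hne
    have := M.rk_lt (hS.2.1 _ hF).1 (hS.2.1 _ hF').1 (h1.ssubset_of_ne hne)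
    omega
  · by_contra hne
    have := M.rk_lt (hS.2.1 _ hF').1 (hS.2.1 _ hF).1 (h1.ssubset_of_ne (Ne.symm hne))
    omega

theorem prevFlat_eq (m : Finset E → ℕ) (F : Finset E) :
    prevFlat m F = ({G ∈ xsupp m | G ⊂ F}).sup id := by
  apply le_antisymm
  · refine Finset.sup_le fun G _ => ?_
    split_ifs with h
    · exact Finset.le_sup (f := id) (Finset.mem_filter.2 ⟨mem_xsupp.2 (Or.inl h.1), h.2⟩)
    · exact bot_le
  · refine Finset.sup_le fun G hG => ?_
    rw [Finset.mem_filter, mem_xsupp] at hG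
    have h : m G ≠ 0 ∧ G ⊂ F := by
      refine ⟨?_, hG.2⟩
      rcases hG.1 with h | rfl
      · exact h
      · exact absurd (Finset.subset_univ F) hG.2.2
    have := Finset.le_sup (s := Finset.univ)
      (f := fun F' => if m F' ≠ 0 ∧ F' ⊂ F then F' else ∅) (Finset.mem_univ G)
    simp only [if_pos h] at this
    exact this

theorem rk_prevFlat {m : Finset E → ℕ} (hS : M.IsXChain (xsupp m)) {F : Finset E}
    (hF : F ∈ xsupp m) :
    M.rk (prevFlat m F) = predIn ((xsupp m).image M.rk) (M.rk F) := by
  rw [prevFlat_eq, predIn]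
  rcases ({G ∈ xsupp m | G ⊂ F}).eq_empty_or_nonempty with h0 | hne
  · rw [h0, Finset.sup_empty]
    have : ({j ∈ (xsupp m).image M.rk | j < M.rk F}) = ∅ := by
      rw [Finset.eq_empty_iff_forall_notMem]
      intro j hj
      rw [Finset.mem_filter, Finset.mem_image] at hj
      obtain ⟨⟨H, hH, rfl⟩, hlt⟩ := hj
      have : H ∈ ({G ∈ xsupp m | G ⊂ F}) := Finset.mem_filter.2 ⟨hH, hS.ssubset hH hF hlt⟩
      rw [h0] at this
      simp at this
    rw [this, Finset.sup_empty]
    exact M.rk_empty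
  · obtain ⟨G, hG, hmax⟩ := Finset.exists_max_image _ M.rk hne
    have hG' := Finset.mem_filter.1 hG
    have e1 : ({G ∈ xsupp m | G ⊂ F}).sup id = G := by
      apply le_antisymm
      · refine Finset.sup_le fun H hH => ?_
        have hH' := Finset.mem_filter.1 hH
        rcases hS.2.2 H hH'.1 G hG'.1 with h | h
        · exact h
        · by_cases he : G = H
          · exact he.ge
          · have := M.rk_lt (hS.2.1 _ hG'.1).1 (hS.2.1 _ hH'.1).1 (h.ssubset_of_ne he)
            have := hmax H hH
            omega
      · exact Finset.le_sup (f := id) hG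
    rw [e1]
    apply le_antisymm
    · refine Finset.le_sup (f := id) (Finset.mem_filter.2 ⟨Finset.mem_image_of_mem _ hG'.1, ?_⟩)
      exact M.rk_lt (hS.2.1 _ hG'.1).1 (hS.2.1 _ hF).1 hG'.2
    · refine Finset.sup_le fun j hj => ?_
      rw [Finset.mem_filter, Finset.mem_image] at hj
      obtain ⟨⟨H, hH, rfl⟩, hlt⟩ := hj
      exact hmax H (Finset.mem_filter.2 ⟨hH, hS.ssubset hH hF hlt⟩)

variable (M) in
/-- exponent vector by rank -/
def expo (m : Finset E → ℕ) (n : ℕ) : ℕ := ∑ F : Finset E, if M.rk F = n then m F else 0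

variable (M) in
/-- rank set of the extended support -/
def rset (m : Finset E → ℕ) : Finset ℕ := (xsupp m).image M.rk

theorem expo_rk {m : Finset E → ℕ} (hS : M.IsXChain (xsupp m)) {F : Finset E}
    (hF : F ∈ xsupp m) : M.expo m (M.rk F) = m F := by
  unfold expo
  rw [Finset.sum_eq_single F]
  · simp
  · intro H _ hne
    split_ifs with h
    · by_contra h0
      exact hne (hS.rk_inj (mem_xsupp.2 (Or.inl h0)) hF h)
    · rfl
  · simp

theorem sum_rset {m : Finset E → ℕ} (hS : M.IsXChain (xsupp m)) (f : ℕ → ℕ) :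
    ∑ n ∈ M.rset m, f n = ∑ F ∈ xsupp m, f (M.rk F) := by
  unfold rset
  exact Finset.sum_image fun F hF F' hF' h => hS.rk_inj hF hF' h

theorem deg_eq (m : Finset E → ℕ) {S : Finset (Finset E)} (hS : ∀ F, F ∉ S → m F = 0) :
    deg m = ∑ F ∈ S, m F := by
  unfold deg
  exact (Finset.sum_subset (Finset.subset_univ _) fun F _ hF => hS F hF).symm

theorem IsFY.chain {m : Finset E → ℕ} (h : M.IsFY m) (hpos : (Finset.univ : Finset E) ≠ ∅) :
    M.IsXChain (xsupp m) := by
  refine ⟨mem_xsupp.2 (Or.inr rfl), ?_, ?_⟩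
  · intro F hF
    rcases mem_xsupp.1 hF with h1 | rfl
    · exact h.1 F h1
    · exact ⟨M.ground_mem, hpos⟩
  · intro F hF F' hF'
    rcases mem_xsupp.1 hF with h1 | rfl
    · rcases mem_xsupp.1 hF' with h2 | rfl
      · exact h.2.1 F F' h1 h2
      · exact Or.inl (Finset.subset_univ _)
    · exact Or.inr (Finset.subset_univ _)

theorem rset_bounds {m : Finset E → ℕ} (hS : M.IsXChain (xsupp m)) {r : ℕ}
    (hr : M.rk Finset.univ = r + 1) :
    r + 1 ∈ M.rset m ∧ ∀ n ∈ M.rset m, 0 < n ∧ n ≤ r + 1 := by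
  constructor
  · rw [← hr]
    exact Finset.mem_image_of_mem _ hS.1
  · intro n hn
    obtain ⟨F, hF, rfl⟩ := Finset.mem_image.1 hn
    obtain ⟨h1, h2⟩ := hS.2.1 F hF
    constructor
    · have := M.rk_lt M.empty_mem h1 (Finset.empty_ssubset.2 (Finset.nonempty_iff_ne_empty.2 h2))
      omega
    · rw [← hr]
      exact M.rk_le h1 M.ground_mem (Finset.subset_univ _)

theorem rk_eq_top {S : Finset (Finset E)} (hS : M.IsXChain S) {r : ℕ}
    (hr : M.rk Finset.univ = r + 1) {F : Finset E} (hF : F ∈ S) :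
    M.rk F = r + 1 ↔ F = Finset.univ := by
  constructor
  · intro h
    exact hS.rk_inj hF hS.1 (h.trans hr.symm)
  · rintro rfl
    exact hr

theorem expo_bounds {m : Finset E → ℕ} (h : M.IsFY m) (hS : M.IsXChain (xsupp m)) {r : ℕ}
    (hr : M.rk Finset.univ = r + 1) :
    ∀ n ∈ M.rset m, loB r n ≤ M.expo m n ∧ M.expo m n ≤ upB (M.rset m) n := by
  intro n hn
  obtain ⟨F, hF, rfl⟩ := Finset.mem_image.1 hn
  rw [expo_rk hS hF]
  constructor
  · unfold loB
    split_ifs with h1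
    · exact Nat.zero_le _
    · rw [rk_eq_top hS hr hF] at h1
      rcases mem_xsupp.1 hF with h2 | h2
      · omega
      · exact absurd h2 h1
  · by_cases h0 : m F = 0
    · omega
    · have := h.2.2 F h0
      rw [rk_prevFlat hS hF] at this
      unfold upB rset
      omega

variable (M) in
/-- Replace the exponents of `m` by those prescribed by rank through `f`. -/
def rebuild (m : Finset E → ℕ) (f : ℕ → ℕ) : Finset E → ℕ :=
  fun F => if F ∈ xsupp m then f (M.rk F) else 0

theorem xsupp_rebuild {m : Finset E → ℕ} (hS : M.IsXChain (xsupp m)) {r : ℕ}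
    (hr : M.rk Finset.univ = r + 1) {f : ℕ → ℕ} (hf : ∀ n ∈ M.rset m, loB r n ≤ f n) :
    xsupp (M.rebuild m f) = xsupp m := by
  ext F
  rw [mem_xsupp (m := M.rebuild m f)]
  unfold rebuild
  by_cases hF : F ∈ xsupp m
  · simp only [hF, if_true, iff_true]
    by_cases hu : F = Finset.univ
    · exact Or.inr hu
    · left
      have := hf _ (Finset.mem_image_of_mem _ hF)
      rw [loB, if_neg (fun h => hu ((rk_eq_top hS hr hF).1 h))] at this
      omega
  · simp only [hF, if_false]
    constructor
    · rintro (h | h)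
      · exact absurd rfl h
      · exact (hF (mem_xsupp.2 (Or.inr h))).elim
    · exact fun h => h.elim

theorem isFY_rebuild {m : Finset E → ℕ} (hS : M.IsXChain (xsupp m)) {r : ℕ}
    (hr : M.rk Finset.univ = r + 1) {f : ℕ → ℕ}
    (hf : ∀ n ∈ M.rset m, loB r n ≤ f n ∧ f n ≤ upB (M.rset m) n) :
    M.IsFY (M.rebuild m f) := by
  have hx := xsupp_rebuild hS hr fun n hn => (hf n hn).1
  have hmem : ∀ F, M.rebuild m f F ≠ 0 → F ∈ xsupp m := by
    intro F hF
    rw [← hx]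
    exact mem_xsupp.2 (Or.inl hF)
  refine ⟨fun F hF => hS.2.1 F (hmem F hF),
    fun F F' hF hF' => hS.2.2 F (hmem F hF) F' (hmem F' hF'), fun F hF => ?_⟩
  have hF' := hmem F hF
  rw [rk_prevFlat (by rw [hx]; exact hS) (by rw [hx]; exact hF'), hx]
  have h1 := (hf _ (Finset.mem_image_of_mem _ hF')).2
  have h2 : M.rebuild m f F = f (M.rk F) := if_pos hF'
  rw [h2] at hF ⊢
  unfold upB rset at h1
  omega

theorem deg_rebuild {m : Finset E → ℕ} (hS : M.IsXChain (xsupp m)) (f : ℕ → ℕ) :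
    deg (M.rebuild m f) = ∑ n ∈ M.rset m, f n := by
  rw [deg_eq (M.rebuild m f) (S := xsupp m) (fun F hF => if_neg hF), sum_rset hS]
  exact Finset.sum_congr rfl fun F hF => if_pos hF

theorem sum_expo {m : Finset E → ℕ} (hS : M.IsXChain (xsupp m)) :
    ∑ n ∈ M.rset m, M.expo m n = deg m := by
  rw [deg_eq m (S := xsupp m) (fun F hF => by
    by_contra h
    exact hF (mem_xsupp.2 (Or.inl h))), sum_rset hS]
  exact Finset.sum_congr rfl fun F hF => expo_rk hS hF

theorem mem_xsupp_mact (g : Equiv.Perm E) (m : Finset E → ℕ) (F : Finset E) :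
    F ∈ xsupp (mact g m) ↔ F.image (g⁻¹ : Equiv.Perm E) ∈ xsupp m := by
  rw [mem_xsupp, mem_xsupp]
  unfold mact
  refine or_congr Iff.rfl ?_
  constructor
  · rintro rfl
    exact Finset.image_univ_equiv _
  · intro h
    rw [← image_image_inv g F, h]
    exact Finset.image_univ_equiv _

theorem rset_mact {g : Equiv.Perm E} (hg : M.IsAut g) {m : Finset E → ℕ}
    (hS : M.IsXChain (xsupp m)) : M.rset (mact g m) = M.rset m := by
  ext n
  unfold rset
  simp only [Finset.mem_image]
  constructor
  · rintro ⟨F, hF, rfl⟩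
    rw [mem_xsupp_mact] at hF
    refine ⟨_, hF, ?_⟩
    have := hg.rk_image _ (hS.2.1 _ hF).1
    rw [image_image_inv] at this
    exact this.symm
  · rintro ⟨F, hF, rfl⟩
    refine ⟨F.image g, ?_, hg.rk_image _ (hS.2.1 _ hF).1⟩
    rw [mem_xsupp_mact, image_inv_image]
    exact hF

theorem expo_mact {g : Equiv.Perm E} (hg : M.IsAut g) {m : Finset E → ℕ}
    (hS : M.IsXChain (xsupp m)) : M.expo (mact g m) = M.expo m := by
  funext n
  unfold expo
  refine Finset.sum_bij' (fun F _ => F.image (g⁻¹ : Equiv.Perm E)) (fun F _ => F.image g)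
    (fun _ _ => Finset.mem_univ _) (fun _ _ => Finset.mem_univ _)
    (fun F _ => image_image_inv g F) (fun F _ => image_inv_image g F) ?_
  intro F _
  unfold mact
  by_cases h0 : m (F.image (g⁻¹ : Equiv.Perm E)) = 0
  · simp only [h0, ite_self]
  · have := hg.rk_image _ (hS.2.1 _ (mem_xsupp.2 (Or.inl h0))).1
    rw [image_image_inv] at this
    rw [this]

theorem rebuild_mact {g : Equiv.Perm E} (hg : M.IsAut g) {m : Finset E → ℕ}
    (hS : M.IsXChain (xsupp m)) (f : ℕ → ℕ) :
    M.rebuild (mact g m) f = mact g (M.rebuild m f) := by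
  funext F
  simp only [rebuild, mact]
  simp only [mem_xsupp_mact]
  by_cases h : F.image (g⁻¹ : Equiv.Perm E) ∈ xsupp m
  · have := hg.rk_image _ (hS.2.1 _ h).1
    rw [image_image_inv] at this
    simp only [h, if_true, this]
  · simp only [h, if_false]

end SimpleFlatMatroid

open SimpleFlatMatroid in
/-- **Theorem (main theorem, part (ii)).** For every finite simple matroid `M` of rank `r+1`
and every `k` with `0 ≤ 2k < r`, there is an injection `λ : FY^k → FY^{k+1}` that is
equivariant for the automorphism group `G` of `M`, i.e. `λ (g • a) = g • λ a`. -/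
theorem fy_equivariant_injection {E : Type*} [Fintype E] [DecidableEq E]
    (M : SimpleFlatMatroid E) (r k : ℕ) (hr : M.rk Finset.univ = r + 1)
    (hk : 2 * k < r) :
    ∃ lam : M.FYk k → M.FYk (k + 1),
      Function.Injective lam ∧
      ∀ g : Equiv.Perm E, M.IsAut g → ∀ a b : M.FYk k,
        (b : Finset E → ℕ) = mact g (a : Finset E → ℕ) →
        ((lam b : M.FYk (k + 1)) : Finset E → ℕ)
          = mact g ((lam a : M.FYk (k + 1)) : Finset E → ℕ) := by
  classical
  have hpos : (Finset.univ : Finset E) ≠ ∅ := by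
    intro h
    rw [h, M.rk_empty] at hr
    omega
  have hex : ∀ R : Finset ℕ, ∃ φ : (ℕ → ℕ) → (ℕ → ℕ),
      (r + 1 ∈ R ∧ ∀ n ∈ R, 0 < n ∧ n ≤ r + 1) → (∀ n ∈ R, loB r n ≤ upB R n) →
      (∀ f, (∀ n ∈ R, loB r n ≤ f n ∧ f n ≤ upB R n) → ∑ n ∈ R, f n = k →
        (∀ n ∈ R, loB r n ≤ φ f n ∧ φ f n ≤ upB R n) ∧ ∑ n ∈ R, φ f n = k + 1) ∧
      (∀ f f', (∀ n ∈ R, loB r n ≤ f n ∧ f n ≤ upB R n) → ∑ n ∈ R, f n = k →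
        (∀ n ∈ R, loB r n ≤ f' n ∧ f' n ≤ upB R n) → ∑ n ∈ R, f' n = k →
        (∀ n ∈ R, φ f n = φ f' n) → ∀ n ∈ R, f n = f' n) := by
    intro R
    by_cases h : (r + 1 ∈ R ∧ ∀ n ∈ R, 0 < n ∧ n ≤ r + 1) ∧ (∀ n ∈ R, loB r n ≤ upB R n)
    · obtain ⟨φ, hφ⟩ := exists_level_injection R (loB r) (upB R) h.2 k
        (by rw [sum_bounds R r h.1.1 h.1.2]; exact hk)
      exact ⟨φ, fun _ _ => hφ⟩
    · exact ⟨id, fun h1 h2 => absurd ⟨h1, h2⟩ h⟩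
  choose φ hφ using hex
  have hch : ∀ a : M.FYk k, M.IsXChain (xsupp a.1) := fun a => a.2.1.chain hpos
  have hb : ∀ a : M.FYk k, ∀ n ∈ M.rset a.1, loB r n ≤ M.expo a.1 n ∧
      M.expo a.1 n ≤ upB (M.rset a.1) n := fun a => expo_bounds a.2.1 (hch a) hr
  have hsum : ∀ a : M.FYk k, ∑ n ∈ M.rset a.1, M.expo a.1 n = k :=
    fun a => (sum_expo (hch a)).trans a.2.2
  have hφ' := fun a : M.FYk k => hφ (M.rset a.1) (rset_bounds (hch a) hr)
    (fun n hn => (hb a n hn).1.trans (hb a n hn).2)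
  have hφ1 := fun a : M.FYk k => (hφ' a).1 (M.expo a.1) (hb a) (hsum a)
  refine ⟨fun a => ⟨M.rebuild a.1 (φ (M.rset a.1) (M.expo a.1)),
    isFY_rebuild (hch a) hr (hφ1 a).1, (deg_rebuild (hch a) _).trans (hφ1 a).2⟩, ?_, ?_⟩
  · intro a b hab
    have hab' : M.rebuild a.1 (φ (M.rset a.1) (M.expo a.1)) =
      M.rebuild b.1 (φ (M.rset b.1) (M.expo b.1)) := congrArg Subtype.val hab
    have hx : xsupp a.1 = xsupp b.1 := by
      rw [← xsupp_rebuild (hch a) hr (fun n hn => ((hφ1 a).1 n hn).1), hab',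
        xsupp_rebuild (hch b) hr (fun n hn => ((hφ1 b).1 n hn).1)]
    have hR : M.rset b.1 = M.rset a.1 := by
      unfold rset
      rw [hx]
    have hbb := hb b
    have hsb := hsum b
    rw [hR] at hbb hsb
    have key := (hφ' a).2 (M.expo a.1) (M.expo b.1) (hb a) (hsum a) hbb hsb (by
      intro n hn
      obtain ⟨F, hF, rfl⟩ := Finset.mem_image.1 hn
      have h1 := congrFun hab' F
      rw [hR] at h1
      unfold rebuild at h1
      rw [if_pos hF, if_pos (hx ▸ hF)] at h1
      exact h1)
    apply Subtype.ext
    funext F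
    by_cases hF : F ∈ xsupp a.1
    · have h1 := key _ (Finset.mem_image_of_mem _ hF)
      rw [expo_rk (hch a) hF, expo_rk (hch b) (hx ▸ hF)] at h1
      exact h1
    · have hF' : F ∉ xsupp b.1 := hx ▸ hF
      rw [mem_xsupp] at hF hF'
      push Not at hF hF'
      rw [hF.1, hF'.1]
  · intro g hg a b hab
    change M.rebuild b.1 (φ (M.rset b.1) (M.expo b.1)) = _
    rw [hab, rset_mact hg (hch a), expo_mact hg (hch a), rebuild_mact hg (hch a)]
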